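/- Let Σ be a binding signature, n : ℕ, t : Trm[n] an n-term, x, y : 𝔸 atoms and σ : 𝔸 → Trm a substitution. If for every atom z in the support of t with z ≠ x, y is fresh for σ z (y # σ z), then σ * (⟨x⟩t) = ⟨y⟩((σ ∘ (x := 𝐚 y)) * t), where σ ∘ (x := 𝐚 y) is the substitution sending x to 𝐚 y and every other atom z to σ z. -/

import Mathlib

/- A Plotkin-style binding signature: operators with arities. -/
structure Sig where
  Op : Type
  ar : Op → List ℕ

/- Well-scoped locally nameless terms and argument lists over a signature.
Atoms are natural numbers. -/
mutual
inductive Trm (S : Sig) : ℕ → Type where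
  | idx : {n : ℕ} → Fin n → Trm S n
  | atm : {n : ℕ} → ℕ → Trm S n
  | op  : {n : ℕ} → (o : S.Op) → Args S n (S.ar o) → Trm S n
inductive Args (S : Sig) : ℕ → List ℕ → Type where
  | nil : {n : ℕ} → Args S n []
  | cons : {n m : ℕ} → {ms : List ℕ} → Trm S (m + n) → Args S n ms → Args S n (m :: ms)
end

variable {S : Sig}

/- Scope weakening. -/
mutual
def Trm.weaken : {m n : ℕ} → m ≤ n → Trm S m → Trm S n
  | _, _, h, .idx i => .idx (Fin.castLE h i)
  | _, _, _, .atm x => .atm x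
  | _, _, h, .op o as => .op o (Args.weaken h as)
def Args.weaken : {m n : ℕ} → {ms : List ℕ} → m ≤ n → Args S m ms → Args S n ms
  | _, _, _, _, .nil => .nil
  | _, _, _, h, .cons t ts => .cons (Trm.weaken (Nat.add_le_add_left h _) t) (Args.weaken h ts)
end

/- Support: the finite set of atoms occurring in a term. -/
mutual
def Trm.supp : {n : ℕ} → Trm S n → Finset ℕ
  | _, .idx _ => ∅
  | _, .atm x => {x}
  | _, .op _ as => Args.supp as
def Args.supp : {n : ℕ} → {ms : List ℕ} → Args S n ms → Finset ℕ
  | _, _, .nil => ∅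
  | _, _, .cons t ts => Trm.supp t ∪ Args.supp ts
end

/- Action of a substitution σ : 𝔸 → Trm on terms. -/
mutual
def Trm.subst (σ : ℕ → Trm S 0) : {n : ℕ} → Trm S n → Trm S n
  | _, .idx i => .idx i
  | n, .atm x => Trm.weaken (Nat.zero_le n) (σ x)
  | _, .op o as => .op o (Args.subst σ as)
def Args.subst (σ : ℕ → Trm S 0) : {n : ℕ} → {ms : List ℕ} → Args S n ms → Args S n ms
  | _, _, .nil => .nil
  | _, _, .cons t ts => .cons (Trm.subst σ t) (Args.subst σ ts)
end

/- The single substitution (x := u). -/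
def single (x : ℕ) (u : Trm S 0) : ℕ → Trm S 0 := fun y => if x = y then u else .atm y

/- Renaming a term along ρ : 𝔸 → 𝔸, i.e. substitution along 𝐚 ∘ ρ. -/
def Trm.rename (ρ : ℕ → ℕ) {n : ℕ} (t : Trm S n) : Trm S n :=
  Trm.subst (fun z => .atm (ρ z)) t

/- Opening (i ↝ u)t : replace index i by the 0-term u. -/
mutual
def Trm.opn : {n : ℕ} → Fin (n+1) → Trm S 0 → Trm S (n+1) → Trm S n
  | n, i, u, .idx j =>
      match finSuccEquiv' i j with
      | none => Trm.weaken (Nat.zero_le n) u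
      | some k => .idx k
  | _, _, _, .atm x => .atm x
  | _, i, u, .op o as => .op o (Args.opn i u as)
def Args.opn : {n : ℕ} → {ms : List ℕ} → Fin (n+1) → Trm S 0 → Args S (n+1) ms → Args S n ms
  | _, _, _, _, .nil => .nil
  | _, _, i, u, .cons (m := k) t ts => .cons (Trm.opn (Fin.natAdd k i) u t) (Args.opn i u ts)
end

/- Concretion t[u] of a (1+n)-term at a 0-term. -/
def Trm.conc {n : ℕ} (t : Trm S (n+1)) (u : Trm S 0) : Trm S n := Trm.opn 0 u t

/- Closing (i ↜ x)t : replace the atom x by the index i. -/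
mutual
def Trm.cls : {n : ℕ} → Fin (n+1) → ℕ → Trm S n → Trm S (n+1)
  | _, i, _, .idx j => .idx (i.succAbove j)
  | _, i, x, .atm y => if x = y then .idx i else .atm y
  | _, i, x, .op o as => .op o (Args.cls i x as)
def Args.cls : {n : ℕ} → {ms : List ℕ} → Fin (n+1) → ℕ → Args S n ms → Args S (n+1) ms
  | _, _, _, _, .nil => .nil
  | _, _, i, x, .cons (m := k) t ts => .cons (Trm.cls (Fin.natAdd k i) x t) (Args.cls i x ts)
end

/- Abstraction ⟨x⟩t. -/
def Trm.abs (x : ℕ) {n : ℕ} (t : Trm S n) : Trm S (n+1) := Trm.cls 0 x t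

/- Size of a term. -/
mutual
def Trm.size : {n : ℕ} → Trm S n → ℕ
  | _, .idx _ => 0
  | _, .atm _ => 0
  | _, .op _ as => 1 + Args.size as
def Args.size : {n : ℕ} → {ms : List ℕ} → Args S n ms → ℕ
  | _, _, .nil => 0
  | _, _, .cons t ts => max (Trm.size t) (Args.size ts)
end

/- Nameful terms, argument lists and n-ary bindings over a signature. -/
mutual
inductive NomTrm (S : Sig) : Type where
  | atm : ℕ → NomTrm S
  | op : (o : S.Op) → NomArg S (S.ar o) → NomTrm S
inductive NomArg (S : Sig) : List ℕ → Type where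
  | nil : NomArg S []
  | cons : {m : ℕ} → {ms : List ℕ} → NomBind S m → NomArg S ms → NomArg S (m :: ms)
inductive NomBind (S : Sig) : ℕ → Type where
  | body : NomTrm S → NomBind S 0
  | bind : {m : ℕ} → ℕ → NomBind S m → NomBind S (m+1)
end

/- Support of a nameful term: all atoms occurring, in atom or binding position. -/
mutual
def NomTrm.nsupp : NomTrm S → Finset ℕ
  | .atm x => {x}
  | .op _ bs => NomArg.nsupp bs
def NomArg.nsupp : {ms : List ℕ} → NomArg S ms → Finset ℕ
  | _, .nil => ∅
  | _, .cons b bs => NomBind.nsupp b ∪ NomArg.nsupp bs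
def NomBind.nsupp : {m : ℕ} → NomBind S m → Finset ℕ
  | _, .body M => NomTrm.nsupp M
  | _, .bind x b => insert x (NomBind.nsupp b)
end

/- Renaming of nameful terms: apply ρ to every atom occurrence, including
binding positions. -/
mutual
def NomTrm.rename (ρ : ℕ → ℕ) : NomTrm S → NomTrm S
  | .atm x => .atm (ρ x)
  | .op o bs => .op o (NomArg.rename ρ bs)
def NomArg.rename (ρ : ℕ → ℕ) : {ms : List ℕ} → NomArg S ms → NomArg S ms
  | _, .nil => .nil
  | _, .cons b bs => .cons (NomBind.rename ρ b) (NomArg.rename ρ bs)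
def NomBind.rename (ρ : ℕ → ℕ) : {m : ℕ} → NomBind S m → NomBind S m
  | _, .body M => .body (NomTrm.rename ρ M)
  | _, .bind x b => .bind (ρ x) (NomBind.rename ρ b)
end

/- The single renaming function sending x to y and fixing all other atoms. -/
def rn1 (x y : ℕ) : ℕ → ℕ := fun z => if x = z then y else z

/- α-equivalence of nameful terms. -/
mutual
inductive AEq {S : Sig} : NomTrm S → NomTrm S → Prop where
  | atm (x : ℕ) : AEq (.atm x) (.atm x)
  | op {o : S.Op} {bs bs' : NomArg S (S.ar o)} :
      AEqArg bs bs' → AEq (.op o bs) (.op o bs')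
inductive AEqArg {S : Sig} : {ms : List ℕ} → NomArg S ms → NomArg S ms → Prop where
  | nil : AEqArg .nil .nil
  | cons {m : ℕ} {ms : List ℕ} {b b' : NomBind S m} {bs bs' : NomArg S ms} :
      AEqBind b b' → AEqArg bs bs' → AEqArg (.cons b bs) (.cons b' bs')
inductive AEqBind {S : Sig} : {m : ℕ} → NomBind S m → NomBind S m → Prop where
  | body {M M' : NomTrm S} : AEq M M' → AEqBind (.body M) (.body M')
  | bind {m : ℕ} {x x' y : ℕ} {b b' : NomBind S m} :
      y ∉ NomBind.nsupp b → y ∉ NomBind.nsupp b' →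
      AEqBind (NomBind.rename (rn1 x y) b) (NomBind.rename (rn1 x' y) b') →
      AEqBind (.bind x b) (.bind x' b')
end

/- Translation of nameful terms into well-scoped locally nameless terms;
bindings translate to iterated abstractions. -/
mutual
def NomTrm.transl : NomTrm S → Trm S 0
  | .atm x => .atm x
  | .op o bs => .op o (NomArg.transl bs)
def NomArg.transl : {ms : List ℕ} → NomArg S ms → Args S 0 ms
  | _, .nil => .nil
  | _, .cons b bs => .cons (NomBind.transl b) (NomArg.transl bs)
def NomBind.transl : {m : ℕ} → NomBind S m → Trm S m
  | _, .body M => NomTrm.transl M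
  | _, .bind x b => Trm.cls 0 x (NomBind.transl b)
end

/- A chosen atom not in a given finite set (one more than its maximum). -/
def newAtom (s : Finset ℕ) : ℕ := s.sup id + 1

/- Capture-avoiding substitution of nameful terms for atoms. -/
mutual
def NomTrm.nsubst (σ : ℕ → NomTrm S) : NomTrm S → NomTrm S
  | .atm x => σ x
  | .op o bs => .op o (NomArg.nsubst σ bs)
def NomArg.nsubst (σ : ℕ → NomTrm S) : {ms : List ℕ} → NomArg S ms → NomArg S ms
  | _, .nil => .nil
  | _, .cons b bs => .cons (NomBind.nsubst σ b) (NomArg.nsubst σ bs)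
def NomBind.nsubst (σ : ℕ → NomTrm S) : {m : ℕ} → NomBind S m → NomBind S m
  | _, .body M => .body (NomTrm.nsubst σ M)
  | _, .bind x b =>
      let y := newAtom ((NomBind.nsupp b).biUnion (fun z => NomTrm.nsupp (σ z)))
      .bind y (NomBind.nsubst (fun z => if x = z then .atm y else σ z) b)
end

mutual
/-- Closing at a fresh atom, with an index beyond the scope of the original term,
is scope weakening. -/
theorem Trm.cls_weaken {m n : ℕ} (h : m ≤ n) (i : Fin (n + 1)) (hi : m ≤ i.val) (y : ℕ) :
    (t : Trm S m) → y ∉ t.supp →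
      Trm.cls i y (Trm.weaken h t) = Trm.weaken (h.trans n.le_succ) t
  | .idx j, _ => by
      have hj : (Fin.castLE h j).castSucc < i := by
        simp only [Fin.lt_def, Fin.val_castSucc, Fin.val_castLE]
        omega
      simp only [Trm.weaken, Trm.cls, Fin.succAbove_of_castSucc_lt _ _ hj]
      rfl
  | .atm z, hy => by
      have hyz : y ≠ z := by simpa [Trm.supp] using hy
      simp [Trm.weaken, Trm.cls, hyz]
  | .op o as, hy => by
      simp only [Trm.supp] at hy
      simp only [Trm.weaken, Trm.cls, Args.cls_weaken h i hi y as hy]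
theorem Args.cls_weaken {m n : ℕ} (h : m ≤ n) (i : Fin (n + 1)) (hi : m ≤ i.val) (y : ℕ) :
    {ms : List ℕ} → (as : Args S m ms) → y ∉ as.supp →
      Args.cls i y (Args.weaken h as) = Args.weaken (h.trans n.le_succ) as
  | _, .nil, _ => by simp only [Args.weaken, Args.cls]
  | _, .cons (m := k) t ts, hy => by
      simp only [Args.supp, Finset.mem_union, not_or] at hy
      simp only [Args.weaken, Args.cls, Args.cls_weaken h i hi y ts hy.2]
      congr 1
      exact Trm.cls_weaken (Nat.add_le_add_left h k) (Fin.natAdd k i)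
        (Nat.add_le_add_left hi k) y t hy.1
end

mutual
/-- Substitution commutes with closing at an arbitrary index, up to changing the closed atom. -/
theorem Trm.subst_cls (x y : ℕ) (σ : ℕ → Trm S 0) {n : ℕ} (i : Fin (n + 1)) :
    (t : Trm S n) → (∀ z ∈ t.supp, z ≠ x → y ∉ (σ z).supp) →
      Trm.subst σ (Trm.cls i x t) =
        Trm.cls i y (Trm.subst (fun z => if x = z then .atm y else σ z) t)
  | .idx j, _ => by simp only [Trm.cls, Trm.subst]
  | .atm z, h => by
      by_cases hxz : x = z
      · simp [Trm.cls, Trm.subst, Trm.weaken, hxz]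
      · have hy : y ∉ (σ z).supp := h z (by simp [Trm.supp]) (Ne.symm hxz)
        simp only [Trm.cls, Trm.subst, hxz, if_false]
        exact (Trm.cls_weaken n.zero_le i i.val.zero_le y (σ z) hy).symm
  | .op o as, h => by
      simp only [Trm.supp] at h
      simp only [Trm.cls, Trm.subst, Args.subst_cls x y σ i as h]
theorem Args.subst_cls (x y : ℕ) (σ : ℕ → Trm S 0) {n : ℕ} (i : Fin (n + 1)) :
    {ms : List ℕ} → (as : Args S n ms) → (∀ z ∈ as.supp, z ≠ x → y ∉ (σ z).supp) →
      Args.subst σ (Args.cls i x as) =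
        Args.cls i y (Args.subst (fun z => if x = z then .atm y else σ z) as)
  | _, .nil, _ => by simp only [Args.cls, Args.subst]
  | _, .cons (m := k) t ts, h => by
      simp only [Args.supp, Finset.mem_union] at h
      simp only [Args.cls, Args.subst,
        Args.subst_cls x y σ i ts fun z hz => h z (Or.inr hz)]
      congr 1
      exact Trm.subst_cls x y σ (Fin.natAdd k i : Fin (k + (n + 1))) t fun z hz => h z (Or.inl hz)
end

/-- σ * (⟨x⟩t) = ⟨y⟩((σ ∘ (x := 𝐚 y)) * t) provided y is fresh for σ z for every
z ∈ supp t with z ≠ x; here σ ∘ (x := 𝐚 y) sends x to 𝐚 y and other z to σ z. -/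
theorem subst_abs (S : Sig) (n : ℕ) (t : Trm S n) (x y : ℕ) (σ : ℕ → Trm S 0)
    (h : ∀ z ∈ t.supp, z ≠ x → y ∉ (σ z).supp) :
    Trm.subst σ (Trm.abs x t) =
      Trm.abs y (Trm.subst (fun z => if x = z then .atm y else σ z) t) :=
  Trm.subst_cls x y σ 0 t h
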